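/- There is a constant C > 0, independent of T, ψ and v, with the following property. Let ψ : [0,T]×ℝ³ → ℝ and v : [0,T]×ℝ³ → ℝ³ be smooth, Schwartz in the space variable for each t. Then the commutator satisfies ‖∂₃³(v·∇ψ) − v·∇(∂₃³ψ)‖_{L²_T(L²(ℝ³))} ≤ C ‖∇v‖_{L²_T(H²)} ‖∇ψ‖_{L^∞_T(H²)}. -/

import Mathlib

open MeasureTheory Real Set Filter
open scoped ENNReal NNReal

noncomputable section

/-- Spatial points of `ℝ³`. -/
abbrev Pt : Type := Fin 3 → ℝ

/-- Partial derivative in the `i`-th coordinate direction. -/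
def pd (i : Fin 3) (f : Pt → ℝ) : Pt → ℝ := fun x => fderiv ℝ f x (Pi.single i 1)

/-- Iterated partial derivative `∂^α` for a multi-index `α`. -/
def pdM (α : Fin 3 → ℕ) (f : Pt → ℝ) : Pt → ℝ :=
  (pd 0)^[α 0] ((pd 1)^[α 1] ((pd 2)^[α 2] f))

/-- Multi-indices of total degree at most `k`. -/
def midx (k : ℕ) : Finset (Fin 3 → ℕ) :=
  (Fintype.piFinset fun _ => Finset.range (k + 1)).filter fun α => ∑ i, α i ≤ k

/-- The `H^k` inner product `(f|g)_{H^k} = ∑_{|α| ≤ k} ∫ ∂^α f ∂^α g`. -/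
def hInner (k : ℕ) (f g : Pt → ℝ) : ℝ := ∑ α ∈ midx k, ∫ x : Pt, pdM α f x * pdM α g x

/-- The squared `H^k` norm. -/
def hSq (k : ℕ) (f : Pt → ℝ) : ℝ := hInner k f f

/-- The squared `L²` norm. -/
def l2Sq (f : Pt → ℝ) : ℝ := ∫ x : Pt, (f x) ^ 2

/-- The Laplacian. -/
def lapl (f : Pt → ℝ) : Pt → ℝ := fun x => ∑ i, pd i (pd i f) x

/-- Horizontal directions. -/
def hIdx : Finset (Fin 3) := {0, 1}

/-- `L^∞` norm in time over `[0,T]` of a (nonnegative) function of time. -/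
def supT (T : ℝ) (g : ℝ → ℝ) : ℝ := sSup (g '' Icc 0 T)

/-- `L²` norm in time over `[0,T]`. -/
def l2T (T : ℝ) (g : ℝ → ℝ) : ℝ := Real.sqrt (∫ t in (0:ℝ)..T, (g t) ^ 2)

/-- `L⁴` norm in time over `[0,T]`. -/
def l4T (T : ℝ) (g : ℝ → ℝ) : ℝ := (∫ t in (0:ℝ)..T, (g t) ^ 4) ^ ((1:ℝ)/4)

/-- A function is Schwartz: smooth with all derivatives rapidly decaying. -/
def IsSchwartz (f : Pt → ℝ) : Prop :=
  ContDiff ℝ (⊤ : ℕ∞) f ∧ ∀ k n : ℕ, ∃ C : ℝ, ∀ x, ‖x‖ ^ k * ‖iteratedFDeriv ℝ n f x‖ ≤ C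

/-- Smoothness of `f` jointly in `(t,x)` on `s ×ˢ ℝ³`. -/
def SmoothOn2 (s : Set ℝ) (f : ℝ → Pt → ℝ) : Prop :=
  ContDiffOn ℝ (⊤ : ℕ∞) (fun q : ℝ × Pt => f q.1 q.2) (s ×ˢ (univ : Set Pt))

/-- `‖∇f‖_{H^k}²`. -/
def gradHSq (k : ℕ) (f : Pt → ℝ) : ℝ := ∑ i, hSq k (pd i f)

/-- `‖∇_h∇f‖_{H^k}²`. -/
def gradHHSq (k : ℕ) (f : Pt → ℝ) : ℝ := ∑ i ∈ hIdx, ∑ j, hSq k (pd i (pd j f))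

/-- `‖v‖_{H^k}²` for a vector field. -/
def vecHSq (k : ℕ) (v : Fin 3 → Pt → ℝ) : ℝ := ∑ j, hSq k (v j)

/-- `‖∇v‖_{H^k}²` for a vector field. -/
def gradVecHSq (k : ℕ) (v : Fin 3 → Pt → ℝ) : ℝ := ∑ j, gradHSq k (v j)

/-- `B_T²`. -/
def BTsq (T : ℝ) (ψ : ℝ → Pt → ℝ) (v : Fin 3 → ℝ → Pt → ℝ) : ℝ :=
  (supT T fun t => Real.sqrt (vecHSq 2 fun j => v j t)) ^ 2
  + (supT T fun t => Real.sqrt (gradHSq 2 (ψ t))) ^ 2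
  + (l2T T fun t => Real.sqrt (gradVecHSq 2 fun j => v j t)) ^ 2
  + (l2T T fun t => Real.sqrt (gradHHSq 1 (ψ t))) ^ 2

/-- `B_T`. -/
def BT (T : ℝ) (ψ : ℝ → Pt → ℝ) (v : Fin 3 → ℝ → Pt → ℝ) : ℝ := Real.sqrt (BTsq T ψ v)

/-- The transport equation `∂_tψ + v·∇ψ + v₃ = 0` on `s × ℝ³`. -/
def TransportEq (s : Set ℝ) (ψ : ℝ → Pt → ℝ) (v : Fin 3 → ℝ → Pt → ℝ) : Prop :=
  ∀ t ∈ s, ∀ x, deriv (fun τ => ψ τ x) t + (∑ i, v i t x * pd i (ψ t) x) + v 2 t x = 0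

/-- Divergence-free condition on `s × ℝ³`. -/
def DivFree (s : Set ℝ) (v : Fin 3 → ℝ → Pt → ℝ) : Prop :=
  ∀ t ∈ s, ∀ x, (∑ i, pd i (fun y => v i t y) x) = 0

/-- The momentum equations of system (S) on `s × ℝ³`. -/
def MomentumEq (s : Set ℝ) (ψ : ℝ → Pt → ℝ) (v : Fin 3 → ℝ → Pt → ℝ)
    (p : ℝ → Pt → ℝ) : Prop :=
  ∀ j : Fin 3, ∀ t ∈ s, ∀ x,
    deriv (fun τ => v j τ x) t + (∑ i, v i t x * pd i (v j t) x) - lapl (v j t) x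
      + pd j (p t) x + pd j (pd 2 (ψ t)) x + (if j = 2 then lapl (ψ t) x else 0)
    = - ∑ i, pd i (fun y => pd j (ψ t) y * pd i (ψ t) y) x

/-- The full system (S) on `s × ℝ³`. -/
def SolvesS (s : Set ℝ) (ψ : ℝ → Pt → ℝ) (v : Fin 3 → ℝ → Pt → ℝ)
    (p : ℝ → Pt → ℝ) : Prop :=
  TransportEq s ψ v ∧ MomentumEq s ψ v p ∧ DivFree s v

/-- Finiteness of the four norms entering `B_T`. -/
def FiniteClass (T : ℝ) (ψ : ℝ → Pt → ℝ) (v : Fin 3 → ℝ → Pt → ℝ) : Prop :=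
  BddAbove ((fun t => Real.sqrt (vecHSq 2 fun j => v j t)) '' Icc 0 T) ∧
  BddAbove ((fun t => Real.sqrt (gradHSq 2 (ψ t))) '' Icc 0 T) ∧
  IntervalIntegrable (fun t => gradVecHSq 2 fun j => v j t) volume 0 T ∧
  IntervalIntegrable (fun t => gradHHSq 1 (ψ t)) volume 0 T


open scoped SchwartzMap

theorem IsSchwartz.exists_schwartzMap {f : Pt → ℝ} (hf : IsSchwartz f) :
    ∃ F : 𝓢(Pt, ℝ), ⇑F = f :=
  ⟨⟨f, hf.1, hf.2⟩, rfl⟩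

theorem SchwartzMap.isSchwartz (F : 𝓢(Pt, ℝ)) : IsSchwartz F := ⟨F.smooth', F.decay'⟩

theorem IsSchwartz.pd {f : Pt → ℝ} (hf : IsSchwartz f) (i : Fin 3) : IsSchwartz (pd i f) := by
  obtain ⟨F, rfl⟩ := hf.exists_schwartzMap
  exact (LineDeriv.lineDerivOp (Pi.single i (1 : ℝ) : Pt) F).isSchwartz

theorem IsSchwartz.mul {f g : Pt → ℝ} (hf : IsSchwartz f) (hg : IsSchwartz g) :
    IsSchwartz (fun x => f x * g x) := by
  obtain ⟨F, rfl⟩ := hf.exists_schwartzMap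
  obtain ⟨G, rfl⟩ := hg.exists_schwartzMap
  have h := (SchwartzMap.smulLeftCLM ℝ F G).isSchwartz
  rwa [SchwartzMap.smulLeftCLM_apply F.hasTemperateGrowth] at h

theorem IsSchwartz.add {f g : Pt → ℝ} (hf : IsSchwartz f) (hg : IsSchwartz g) :
    IsSchwartz (fun x => f x + g x) := by
  obtain ⟨F, rfl⟩ := hf.exists_schwartzMap
  obtain ⟨G, rfl⟩ := hg.exists_schwartzMap
  exact (F + G).isSchwartz

theorem IsSchwartz.pow {f : Pt → ℝ} (hf : IsSchwartz f) (n : ℕ) :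
    IsSchwartz (fun x => f x ^ (n + 1)) := by
  induction n with
  | zero => simpa using hf
  | succ n ih => simpa only [pow_succ _ (n + 1)] using ih.mul hf

theorem IsSchwartz.differentiable {f : Pt → ℝ} (hf : IsSchwartz f) : Differentiable ℝ f :=
  hf.1.differentiable (by simp)

theorem IsSchwartz.continuous {f : Pt → ℝ} (hf : IsSchwartz f) : Continuous f :=
  hf.1.continuous

theorem IsSchwartz.integrable {f : Pt → ℝ} (hf : IsSchwartz f) : Integrable f := by
  obtain ⟨F, rfl⟩ := hf.exists_schwartzMap
  exact F.integrable

theorem IsSchwartz.integrable_sq {f : Pt → ℝ} (hf : IsSchwartz f) :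
    Integrable (fun x => f x ^ 2) := (hf.pow 1).integrable

theorem IsSchwartz.pd_comm {f : Pt → ℝ} (hf : IsSchwartz f) (i j : Fin 3) :
    _root_.pd i (_root_.pd j f) = _root_.pd j (_root_.pd i f) := by
  obtain ⟨F, rfl⟩ := hf.exists_schwartzMap
  have h (a b : Fin 3) (x : Pt) : _root_.pd a (_root_.pd b F) x =
      fderiv ℝ (fderiv ℝ F) x (Pi.single a 1) (Pi.single b 1) := by
    have hd : DifferentiableAt ℝ (fderiv ℝ F) x :=
      ((F.smooth ⊤).fderiv_right (m := 1) (by norm_cast)).differentiable (by simp) x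
    simp only [_root_.pd]
    change fderiv ℝ (fun y => fderiv ℝ F y (Pi.single b 1)) x (Pi.single a 1) = _
    rw [fderiv_clm_apply hd (differentiableAt_const _)]
    simp
  funext x
  rw [h, h]
  exact ((F.smooth 2).contDiffAt.isSymmSndFDerivAt (by simp)) _ _

theorem pd_mul {f g : Pt → ℝ} (hf : Differentiable ℝ f) (hg : Differentiable ℝ g) (i : Fin 3) :
    pd i (fun x => f x * g x) = fun x => pd i f x * g x + f x * pd i g x := by
  funext x
  simp only [pd]
  rw [fderiv_fun_mul (hf x) (hg x)]
  simp
  ring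

theorem pd_add {f g : Pt → ℝ} (hf : Differentiable ℝ f) (hg : Differentiable ℝ g) (i : Fin 3) :
    pd i (fun x => f x + g x) = fun x => pd i f x + pd i g x := by
  funext x
  simp only [pd]
  rw [fderiv_fun_add (hf x) (hg x)]
  simp

theorem pd_sum {f : Fin 3 → Pt → ℝ} (hf : ∀ j, Differentiable ℝ (f j)) (i : Fin 3) :
    pd i (fun x => ∑ j, f j x) = fun x => ∑ j, pd i (f j) x := by
  funext x
  simp only [pd]
  rw [fderiv_fun_sum fun j _ => hf j x]
  simp

/-- The Leibniz rule for a triple derivative in one direction. -/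
theorem pd_pd_pd_mul {f g : Pt → ℝ} (hf : IsSchwartz f) (hg : IsSchwartz g) (i : Fin 3) :
    pd i (pd i (pd i fun x => f x * g x)) = fun x =>
      pd i (pd i (pd i f)) x * g x + 3 * (pd i (pd i f) x * pd i g x)
        + 3 * (pd i f x * pd i (pd i g) x) + f x * pd i (pd i (pd i g)) x := by
  have h {a b : Pt → ℝ} (ha : IsSchwartz a) (hb : IsSchwartz b) :=
    ha.mul hb
  have hm {a b : Pt → ℝ} (ha : IsSchwartz a) (hb : IsSchwartz b) :=
    pd_mul ha.differentiable hb.differentiable i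
  have hf1 := hf.pd i
  have hf2 := hf1.pd i
  have hg1 := hg.pd i
  have hg2 := hg1.pd i
  have hadd {a b : Pt → ℝ} (ha : IsSchwartz a) (hb : IsSchwartz b) :=
    pd_add ha.differentiable hb.differentiable i
  rw [hm hf hg, hadd (h hf1 hg) (h hf hg1), hm hf1 hg, hm hf hg1,
    hadd ((h hf2 hg).add (h hf1 hg1)) ((h hf1 hg1).add (h hf hg2)),
    hadd (h hf2 hg) (h hf1 hg1), hadd (h hf1 hg1) (h hf hg2),
    hm hf2 hg, hm hf1 hg1, hm hf hg2]
  funext x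
  ring

theorem sq_integral_mul_le {α : Type*} [MeasurableSpace α] {μ : Measure α} {f g : α → ℝ}
    (hf : Integrable (fun x => f x ^ 2) μ) (hg : Integrable (fun x => g x ^ 2) μ)
    (hfg : Integrable (fun x => f x * g x) μ) :
    (∫ x, f x * g x ∂μ) ^ 2 ≤ (∫ x, f x ^ 2 ∂μ) * ∫ x, g x ^ 2 ∂μ := by
  have h (t : ℝ) : 0 ≤ (∫ x, f x ^ 2 ∂μ) * (t * t) + (2 * ∫ x, f x * g x ∂μ) * t
      + ∫ x, g x ^ 2 ∂μ := by
    have h0 : 0 ≤ ∫ x, (t * f x + g x) ^ 2 ∂μ := integral_nonneg fun x => sq_nonneg _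
    have h1 : ∫ x, (t * f x + g x) ^ 2 ∂μ =
        ∫ x, (t * t * f x ^ 2 + 2 * t * (f x * g x)) + g x ^ 2 ∂μ := by
      congr 1; funext x; ring
    have h2 : Integrable (fun x => t * t * f x ^ 2 + 2 * t * (f x * g x)) μ :=
      (hf.const_mul _).add (hfg.const_mul _)
    rw [h1, integral_add h2 hg, integral_add (hf.const_mul _) (hfg.const_mul _), integral_const_mul,
      integral_const_mul] at h0
    linarith
  have := discrim_le_zero h
  unfold discrim at this
  linarith

theorem integral_sq_pdM_le_hSq {k : ℕ} {α : Fin 3 → ℕ} (hα : α ∈ midx k) (f : Pt → ℝ) :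
    ∫ x, pdM α f x ^ 2 ≤ hSq k f := by
  simp only [pow_two]
  exact Finset.single_le_sum (f := fun α => ∫ x, pdM α f x * pdM α f x)
    (fun β _ => integral_nonneg fun x => mul_self_nonneg _) hα

theorem hSq_nonneg (k : ℕ) (f : Pt → ℝ) : 0 ≤ hSq k f :=
  Finset.sum_nonneg fun _ _ => integral_nonneg fun _ => mul_self_nonneg _

theorem integral_sq_le_hSq (f : Pt → ℝ) : ∫ x, f x ^ 2 ≤ hSq 2 f :=
  integral_sq_pdM_le_hSq (α := ![0, 0, 0]) (by decide) f

theorem integral_sq_pd_le_hSq (f : Pt → ℝ) (i : Fin 3) : ∫ x, pd i f x ^ 2 ≤ hSq 2 f := by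
  fin_cases i
  · exact integral_sq_pdM_le_hSq (α := ![1, 0, 0]) (by decide) f
  · exact integral_sq_pdM_le_hSq (α := ![0, 1, 0]) (by decide) f
  · exact integral_sq_pdM_le_hSq (α := ![0, 0, 1]) (by decide) f

theorem IsSchwartz.integral_sq_pd_pd_le_hSq {f : Pt → ℝ} (hf : IsSchwartz f) (i j : Fin 3) :
    ∫ x, _root_.pd i (_root_.pd j f) x ^ 2 ≤ hSq 2 f := by
  wlog hij : i ≤ j generalizing i j
  · rw [hf.pd_comm]
    exact this j i (le_of_not_ge hij)
  fin_cases i <;> fin_cases j <;> first | exact absurd hij (by decide) | skip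
  · exact integral_sq_pdM_le_hSq (α := ![2, 0, 0]) (by decide) f
  · exact integral_sq_pdM_le_hSq (α := ![1, 1, 0]) (by decide) f
  · exact integral_sq_pdM_le_hSq (α := ![1, 0, 1]) (by decide) f
  · exact integral_sq_pdM_le_hSq (α := ![0, 2, 0]) (by decide) f
  · exact integral_sq_pdM_le_hSq (α := ![0, 1, 1]) (by decide) f
  · exact integral_sq_pdM_le_hSq (α := ![0, 0, 2]) (by decide) f

theorem hasDerivAt_pd_line {f : Pt → ℝ} (hf : Differentiable ℝ f) (x y : Pt) (s : ℝ) :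
    HasDerivAt (fun s : ℝ => f (x + s • y)) (∑ i, y i * pd i f (x + s • y)) s := by
  have h1 : HasDerivAt (fun s : ℝ => x + s • y) y s := by
    simpa using ((hasDerivAt_id s).smul_const y).const_add x
  have h2 := (hf (x + s • y)).hasFDerivAt.comp_hasDerivAt s h1
  have key (L : Pt →L[ℝ] ℝ) : L y = ∑ i, y i * L (Pi.single i 1) := by
    rw [← Finset.univ_sum_single y, map_sum]
    refine Finset.sum_congr rfl fun i _ => ?_
    have : (Pi.single i (y i) : Pt) = y i • Pi.single i 1 := by
      rw [← Pi.single_smul, smul_eq_mul, mul_one]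
    rw [Finset.univ_sum_single, this, map_smul, smul_eq_mul]
  rwa [key] at h2

/-- Second-order Taylor formula based at `x + y`, with integral remainder. -/
theorem IsSchwartz.taylor {f : Pt → ℝ} (hf : IsSchwartz f) (x y : Pt) :
    f x = f (x + y) - (∑ i, y i * _root_.pd i f (x + y))
      + ∫ s in (0:ℝ)..1, s * ∑ i, y i * ∑ j, y j *
          _root_.pd j (_root_.pd i f) (x + s • y) := by
  have hd (s : ℝ) : HasDerivAt
      (fun s : ℝ => s * (∑ i, y i * _root_.pd i f (x + s • y)) - f (x + s • y))
      (s * ∑ i, y i * ∑ j, y j * _root_.pd j (_root_.pd i f) (x + s • y)) s := by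
    have h1 : HasDerivAt (fun s : ℝ => ∑ i, y i * _root_.pd i f (x + s • y))
        (∑ i, y i * ∑ j, y j * _root_.pd j (_root_.pd i f) (x + s • y)) s :=
      HasDerivAt.fun_sum fun i _ =>
        (hasDerivAt_pd_line (hf.pd i).differentiable x y s).const_mul (y i)
    convert! ((hasDerivAt_id s).mul h1).sub (hasDerivAt_pd_line hf.differentiable x y s) using 1
    simp
  have hc : Continuous fun s : ℝ =>
      s * ∑ i, y i * ∑ j, y j * _root_.pd j (_root_.pd i f) (x + s • y) := by
    have h2 (i j : Fin 3) := ((hf.pd i).pd j).continuous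
    fun_prop
  rw [intervalIntegral.integral_eq_sub_of_hasDerivAt (fun s _ => hd s)
    (hc.intervalIntegrable 0 1)]
  simp only [one_mul, one_smul, zero_mul, zero_smul, add_zero]
  ring

theorem IsSchwartz.setIntegral_abs_dilation_le {f : Pt → ℝ} (hf : IsSchwartz f) (x : Pt) {s : ℝ}
    (hs : 0 < s) :
    ∫ y in Icc (0 : Pt) 1, |f (x + s • y)| ≤ s ^ (-(3 / 2) : ℝ) * √(∫ y, f y ^ 2) := by
  have hvol : volume.real (Icc (0 : Pt) 1) = 1 := by
    simp [Measure.real, Real.volume_Icc_pi]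
  have hc : Continuous fun y : Pt => |f (x + s • y)| := by
    have := hf.continuous
    fun_prop
  have hint : Integrable (fun y : Pt => |f (x + s • y)| ^ 2) := by
    simp only [sq_abs]
    exact ((hf.integrable_sq.comp_add_left x).comp_smul hs.ne')
  have hcs := sq_integral_mul_le (μ := volume.restrict (Icc (0 : Pt) 1))
    (f := fun y => |f (x + s • y)|) (g := fun _ => 1)
    hint.integrableOn (continuousOn_const.integrableOn_compact isCompact_Icc)
    ((hc.mul continuous_const).continuousOn.integrableOn_compact isCompact_Icc)
  have hscale : ∫ y : Pt, |f (x + s • y)| ^ 2 = (s ^ (-(3 / 2) : ℝ)) ^ 2 * ∫ y, f y ^ 2 := by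
    simp only [sq_abs]
    rw [Measure.integral_comp_smul volume (fun y => f (x + y) ^ 2) s,
      integral_add_left_eq_self (fun y => f y ^ 2) x, ← Real.rpow_mul_natCast hs.le]
    norm_num [abs_of_pos hs, Real.rpow_neg hs.le]
  have hle : ∫ y in Icc (0 : Pt) 1, |f (x + s • y)| ^ 2 ≤ ∫ y : Pt, |f (x + s • y)| ^ 2 :=
    setIntegral_le_integral hint (ae_of_all _ fun y => by positivity)
  simp only [mul_one, one_pow, integral_const, measureReal_restrict_apply_univ, hvol,
    smul_eq_mul] at hcs
  rw [← Real.sqrt_sq (by positivity : 0 ≤ s ^ (-(3 / 2) : ℝ)), ← Real.sqrt_mul (by positivity),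
    ← hscale]
  exact Real.le_sqrt_of_sq_le (hcs.trans hle)

theorem IsSchwartz.setIntegral_remainder_le {f : Pt → ℝ} (hf : IsSchwartz f) (x : Pt) :
    ∫ y in Icc (0 : Pt) 1, ∫ s in (0:ℝ)..1, s * |f (x + s • y)| ≤ 2 * √(∫ y, f y ^ 2) := by
  have hfc := hf.continuous
  simp only [intervalIntegral.integral_of_le zero_le_one]
  rw [integral_integral_swap]
  · have hle : ∫ s in Ioc (0:ℝ) 1, ∫ y in Icc (0 : Pt) 1, s * |f (x + s • y)| ≤
        ∫ s in Ioc (0:ℝ) 1, s ^ (-(1 / 2) : ℝ) * √(∫ y, f y ^ 2) := by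
      refine integral_mono_of_nonneg ?_ ?_ ?_
      · filter_upwards [ae_restrict_mem measurableSet_Ioc] with s hs
        exact integral_nonneg fun y => mul_nonneg hs.1.le (abs_nonneg _)
      · refine Integrable.mul_const ?_ _
        exact (intervalIntegral.intervalIntegrable_rpow' (by norm_num)).1
      · filter_upwards [ae_restrict_mem measurableSet_Ioc] with s hs
        rw [integral_const_mul]
        refine (mul_le_mul_of_nonneg_left (hf.setIntegral_abs_dilation_le x hs.1)
          hs.1.le).trans_eq ?_
        rw [← mul_assoc, ← Real.rpow_one_add' hs.1.le (by norm_num)]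
        norm_num
    refine hle.trans_eq ?_
    rw [integral_mul_const, ← intervalIntegral.integral_of_le zero_le_one,
      integral_rpow (by norm_num)]
    norm_num
  · have h1 : IntegrableOn (Function.uncurry fun (y : Pt) (s : ℝ) => s * |f (x + s • y)|)
        (Icc (0 : Pt) 1 ×ˢ Icc (0:ℝ) 1) (volume.prod volume) := by
      refine ContinuousOn.integrableOn_compact (isCompact_Icc.prod isCompact_Icc) ?_
      exact Continuous.continuousOn (by unfold Function.uncurry; fun_prop)
    rw [Measure.prod_restrict]
    exact h1.mono_set (Set.prod_mono subset_rfl Ioc_subset_Icc_self)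

/-- The Sobolev embedding `H² ⊂ L^∞` in three dimensions. -/
theorem IsSchwartz.sq_le_hSq {f : Pt → ℝ} (hf : IsSchwartz f) (x : Pt) :
    f x ^ 2 ≤ 484 * hSq 2 f := by
  have hvol : volume.real (Icc (0 : Pt) 1) = 1 := by
    simp [Measure.real, Real.volume_Icc_pi]
  have hc1 (i : Fin 3) := (hf.pd i).continuous
  have hc2 (i j : Fin 3) := ((hf.pd i).pd j).continuous
  have hc := hf.continuous
  have hrem (i j : Fin 3) : Continuous fun y : Pt =>
      ∫ s in (0:ℝ)..1, s * |_root_.pd j (_root_.pd i f) (x + s • y)| := by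
    refine intervalIntegral.continuous_parametric_intervalIntegral_of_continuous' ?_ 0 1
    unfold Function.uncurry
    fun_prop
  have hpt : ∀ y ∈ Icc (0 : Pt) 1, |f x| ≤ |f (x + y)| + (∑ i, |_root_.pd i f (x + y)|)
      + ∑ i, ∑ j, ∫ s in (0:ℝ)..1, s * |_root_.pd j (_root_.pd i f) (x + s • y)| := by
    intro y hy
    have hy' (i : Fin 3) (a : ℝ) : |y i * a| ≤ |a| := by
      rw [abs_mul, abs_of_nonneg (hy.1 i)]
      exact mul_le_of_le_one_left (abs_nonneg a) (hy.2 i)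
    rw [hf.taylor x y]
    refine (abs_add_le _ _).trans (add_le_add ((abs_sub _ _).trans (add_le_add le_rfl ?_)) ?_)
    · exact (Finset.abs_sum_le_sum_abs _ _).trans (Finset.sum_le_sum fun i _ => hy' i _)
    · have hii (i j : Fin 3) : IntervalIntegrable
          (fun s : ℝ => s * |_root_.pd j (_root_.pd i f) (x + s • y)|) volume 0 1 :=
        Continuous.intervalIntegrable (by fun_prop) 0 1
      have hsum : ∑ i, ∑ j, ∫ s in (0:ℝ)..1, s * |_root_.pd j (_root_.pd i f) (x + s • y)| =
          ∫ s in (0:ℝ)..1, ∑ i, ∑ j, s * |_root_.pd j (_root_.pd i f) (x + s • y)| := by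
        rw [intervalIntegral.integral_finsetSum fun i _ =>
          Continuous.intervalIntegrable (by fun_prop) 0 1]
        refine Finset.sum_congr rfl fun i _ => ?_
        rw [intervalIntegral.integral_finsetSum fun j _ => hii i j]
      rw [hsum]
      refine (intervalIntegral.abs_integral_le_integral_abs zero_le_one).trans ?_
      refine intervalIntegral.integral_mono_on zero_le_one
        (Continuous.intervalIntegrable (by fun_prop) 0 1)
        (Continuous.intervalIntegrable (by fun_prop) 0 1) fun s hs => ?_
      rw [abs_mul, abs_of_nonneg hs.1]
      simp only [← Finset.mul_sum]
      refine mul_le_mul_of_nonneg_left ?_ hs.1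
      refine (Finset.abs_sum_le_sum_abs _ _).trans (Finset.sum_le_sum fun i _ => ?_)
      exact (hy' i _).trans
        ((Finset.abs_sum_le_sum_abs _ _).trans (Finset.sum_le_sum fun j _ => hy' j _))
  have hI {g : Pt → ℝ} (hg : Continuous g) : IntegrableOn g (Icc (0 : Pt) 1) :=
    hg.continuousOn.integrableOn_compact isCompact_Icc
  have hmono : |f x| ≤ (∫ y in Icc (0 : Pt) 1, |f (x + y)|)
      + (∑ i, ∫ y in Icc (0 : Pt) 1, |_root_.pd i f (x + y)|)
      + ∑ i, ∑ j, ∫ y in Icc (0 : Pt) 1,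
          ∫ s in (0:ℝ)..1, s * |_root_.pd j (_root_.pd i f) (x + s • y)| := by
    have h := setIntegral_mono_on (μ := volume) (hI (continuous_const (y := |f x|)))
      (hI (by fun_prop)) measurableSet_Icc hpt
    rw [setIntegral_const, hvol, one_smul] at h
    refine h.trans_eq ?_
    rw [integral_add (hI (by fun_prop)) (hI (by fun_prop)),
      integral_add (hI (by fun_prop)) (hI (by fun_prop)),
      integral_finsetSum _ fun i _ => hI (by fun_prop),
      integral_finsetSum _ fun i _ => hI (by fun_prop)]
    congr 1
    refine Finset.sum_congr rfl fun i _ => ?_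
    rw [integral_finsetSum _ fun j _ => hI (hrem i j)]
  have hunit {g : Pt → ℝ} (hg : IsSchwartz g) (hle : ∫ y, g y ^ 2 ≤ hSq 2 f) :
      ∫ y in Icc (0 : Pt) 1, |g (x + y)| ≤ √(hSq 2 f) := by
    have h := hg.setIntegral_abs_dilation_le x one_pos
    simp only [one_smul, Real.one_rpow, one_mul] at h
    exact h.trans (Real.sqrt_le_sqrt hle)
  have h0 := hunit hf (integral_sq_le_hSq f)
  have h1 := Finset.sum_le_sum fun i (_ : i ∈ Finset.univ) =>
    hunit (hf.pd i) (integral_sq_pd_le_hSq f i)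
  have h2 := Finset.sum_le_sum fun i (_ : i ∈ Finset.univ) =>
    Finset.sum_le_sum fun j (_ : j ∈ Finset.univ) =>
      (((hf.pd i).pd j).setIntegral_remainder_le x).trans
        (mul_le_mul_of_nonneg_left (Real.sqrt_le_sqrt (hf.integral_sq_pd_pd_le_hSq j i))
          zero_le_two)
  simp only [Finset.sum_const, Finset.card_univ, Fintype.card_fin, nsmul_eq_mul] at h1 h2
  have hfin : |f x| ≤ 22 * √(hSq 2 f) := by
    push_cast at h1 h2
    linarith
  calc f x ^ 2 = |f x| ^ 2 := (sq_abs _).symm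
    _ ≤ (22 * √(hSq 2 f)) ^ 2 := pow_le_pow_left₀ (abs_nonneg _) hfin 2
    _ = 484 * hSq 2 f := by rw [mul_pow, Real.sq_sqrt (hSq_nonneg 2 f)]; norm_num

/-- The Gagliardo–Nirenberg inequality `‖∂ᵢf‖_{L⁴}² ≲ ‖f‖_{L^∞} ‖∂ᵢ²f‖_{L²}`, in terms of the
`H²` norm. -/
theorem IsSchwartz.integral_pd_pow_four_le {f : Pt → ℝ} (hf : IsSchwartz f) (i : Fin 3) :
    ∫ x, _root_.pd i f x ^ 4 ≤ 4356 * hSq 2 f ^ 2 := by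
  set P := _root_.pd i f
  have hPs : IsSchwartz P := hf.pd i
  set Q := _root_.pd i P with hQ
  have hQs : IsSchwartz Q := hPs.pd i
  have hder : _root_.pd i (fun x => P x ^ 3) = fun x => 3 * (P x ^ 2 * Q x) := by
    funext x
    have h := (hPs.differentiable x).hasFDerivAt.pow 3
    have h' : _root_.pd i (fun x => P x ^ 3) x = _ := congrArg (· (Pi.single i 1)) h.fderiv
    rw [h']
    simp [hQ, _root_.pd]
    ring
  have hfQ := hf.mul hQs
  have hP2 := hPs.pow 1
  have hint := hP2.mul hfQ
  have hibp : ∫ x, P x ^ 4 = -3 * ∫ x, P x ^ 2 * (f x * Q x) := by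
    have hfd : Integrable fun x => f x * _root_.pd i (fun x => P x ^ 3) x :=
      (hf.mul ((hPs.pow 2).pd i)).integrable
    have h := integral_mul_fderiv_eq_neg_fderiv_mul_of_integrable (μ := (volume : Measure Pt))
      (f := f) (g := fun x => P x ^ 3) (v := Pi.single i 1)
      (hPs.mul (hPs.pow 2)).integrable hfd
      (hf.mul (hPs.pow 2)).integrable (fun x _ => hf.differentiable x)
      (fun x _ => (hPs.pow 2).differentiable x)
    change ∫ x, f x * _root_.pd i (fun x => P x ^ 3) x = -∫ x, P x * P x ^ 3 at h
    rw [hder] at h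
    have h4 : ∫ x, P x * P x ^ 3 = ∫ x, P x ^ 4 := by congr 1; funext x; ring
    have h3 : ∫ x, f x * (3 * (P x ^ 2 * Q x)) = 3 * ∫ x, P x ^ 2 * (f x * Q x) := by
      rw [← integral_const_mul]; congr 1; funext x; ring
    linarith
  have hcs := sq_integral_mul_le hP2.integrable_sq hfQ.integrable_sq hint.integrable
  have h4 : ∫ x, (P x ^ (1 + 1)) ^ 2 = ∫ x, P x ^ 4 := by congr 1; funext x; ring
  have hfQ2 : ∫ x, (f x * Q x) ^ 2 ≤ 484 * hSq 2 f * hSq 2 f := by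
    calc ∫ x, (f x * Q x) ^ 2 ≤ ∫ x, 484 * hSq 2 f * Q x ^ 2 := by
          refine integral_mono hfQ.integrable_sq (hQs.integrable_sq.const_mul _) fun x => ?_
          simp only [mul_pow]
          exact mul_le_mul_of_nonneg_right (hf.sq_le_hSq x) (sq_nonneg _)
      _ = 484 * hSq 2 f * ∫ x, Q x ^ 2 := integral_const_mul _ _
      _ ≤ _ := mul_le_mul_of_nonneg_left (hf.integral_sq_pd_pd_le_hSq i i)
          (mul_nonneg (by norm_num) (hSq_nonneg 2 f))
  have h0 : 0 ≤ ∫ x, P x ^ 4 := integral_nonneg fun x => by positivity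
  rw [h4] at hcs
  rcases h0.eq_or_lt with h0 | h0
  · rw [← h0]; positivity
  · have h5 := mul_le_mul_of_nonneg_left hfQ2 h0.le
    refine le_of_mul_le_mul_left ?_ h0
    calc (∫ x, P x ^ 4) * ∫ x, P x ^ 4
        = 9 * (∫ x, P x ^ 2 * (f x * Q x)) ^ 2 := by rw [hibp]; ring
      _ ≤ (∫ x, P x ^ 4) * (4356 * hSq 2 f ^ 2) := by linarith

theorem IsSchwartz.integral_sq_mul_le {f g : Pt → ℝ} (hf : IsSchwartz f) (hg : IsSchwartz g) :
    ∫ x, (f x * g x) ^ 2 ≤ 484 * hSq 2 f * ∫ x, g x ^ 2 := by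
  rw [← integral_const_mul]
  refine integral_mono (hf.mul hg).integrable_sq (hg.integrable_sq.const_mul _) fun x => ?_
  simp only [mul_pow]
  exact mul_le_mul_of_nonneg_right (hf.sq_le_hSq x) (sq_nonneg _)

theorem IsSchwartz.integral_sq_pd_mul_pd_le {f g : Pt → ℝ} (hf : IsSchwartz f)
    (hg : IsSchwartz g) (i : Fin 3) :
    ∫ x, (_root_.pd i f x * _root_.pd i g x) ^ 2 ≤ 4356 * (hSq 2 f * hSq 2 g) := by
  have hf2 := (hf.pd i).pow 1
  have hg2 := (hg.pd i).pow 1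
  have hcs := sq_integral_mul_le hf2.integrable_sq hg2.integrable_sq (hf2.mul hg2).integrable
  simp only [← pow_mul] at hcs
  have hf4 := hf.integral_pd_pow_four_le i
  have hg4 := hg.integral_pd_pow_four_le i
  have hmul := mul_le_mul hf4 hg4 (integral_nonneg fun x => by positivity) (by positivity)
  have hfg := mul_nonneg (hSq_nonneg 2 f) (hSq_nonneg 2 g)
  have heq : ∫ x, (_root_.pd i f x * _root_.pd i g x) ^ 2 =
      ∫ x, _root_.pd i f x ^ (1 + 1) * _root_.pd i g x ^ (1 + 1) := by
    congr 1; funext x; ring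
  rw [heq]
  exact abs_le_of_sq_le_sq' ((hcs.trans hmul).trans_eq (by ring)) (by positivity) |>.2

/-- The `L²` bound for the part of `∂ᵢ³(ug)` in which a derivative falls on `u`. -/
theorem integral_sq_commutator_le {u g : Pt → ℝ} (hu : IsSchwartz u) (hg : IsSchwartz g)
    (i : Fin 3) :
    ∫ x, (pd i (pd i (pd i u)) x * g x + 3 * (pd i (pd i u) x * pd i g x)
        + 3 * (pd i u x * pd i (pd i g) x)) ^ 2 ≤ 132132 * (hSq 2 (pd i u) * hSq 2 g) := by
  have hw := hu.pd i
  have ha := ((hw.pd i).pd i).mul hg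
  have hb := (hw.pd i).mul (hg.pd i)
  have hc := hw.mul ((hg.pd i).pd i)
  have hA : ∫ x, (pd i (pd i (pd i u)) x * g x) ^ 2 ≤ 484 * (hSq 2 (pd i u) * hSq 2 g) := by
    have h := hg.integral_sq_mul_le ((hw.pd i).pd i)
    simp only [mul_comm (g _)] at h
    refine h.trans ((mul_le_mul_of_nonneg_left (hw.integral_sq_pd_pd_le_hSq i i)
      (mul_nonneg (by norm_num) (hSq_nonneg 2 g))).trans_eq (by ring))
  have hB := hw.integral_sq_pd_mul_pd_le hg i
  have hC : ∫ x, (pd i u x * pd i (pd i g) x) ^ 2 ≤ 484 * (hSq 2 (pd i u) * hSq 2 g) := by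
    refine (hw.integral_sq_mul_le ((hg.pd i).pd i)).trans
      ((mul_le_mul_of_nonneg_left (hg.integral_sq_pd_pd_le_hSq i i)
      (mul_nonneg (by norm_num) (hSq_nonneg 2 _))).trans_eq (by ring))
  have hab : Integrable fun x => 3 * (pd i (pd i (pd i u)) x * g x) ^ 2
      + 27 * (pd i (pd i u) x * pd i g x) ^ 2 :=
    (ha.integrable_sq.const_mul 3).add (hb.integrable_sq.const_mul 27)
  have hle : ∫ x, (pd i (pd i (pd i u)) x * g x + 3 * (pd i (pd i u) x * pd i g x)
        + 3 * (pd i u x * pd i (pd i g) x)) ^ 2 ≤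
      ∫ x, ((3 * (pd i (pd i (pd i u)) x * g x) ^ 2 + 27 * (pd i (pd i u) x * pd i g x) ^ 2)
        + 27 * (pd i u x * pd i (pd i g) x) ^ 2) := by
    refine integral_mono_of_nonneg (ae_of_all _ fun x => sq_nonneg _)
      (hab.add (hc.integrable_sq.const_mul 27)) (ae_of_all _ fun x => ?_)
    dsimp only
    generalize pd i (pd i (pd i u)) x * g x = a
    generalize pd i (pd i u) x * pd i g x = b
    generalize pd i u x * pd i (pd i g) x = c
    nlinarith [sq_nonneg (a - 3 * b), sq_nonneg (a - 3 * c), sq_nonneg (3 * b - 3 * c)]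
  rw [integral_add hab (hc.integrable_sq.const_mul 27),
    integral_add (ha.integrable_sq.const_mul 3) (hb.integrable_sq.const_mul 27),
    integral_const_mul, integral_const_mul, integral_const_mul] at hle
  linarith

theorem commutator_eq_sum {ψ : Pt → ℝ} {v : Fin 3 → Pt → ℝ} (hψ : IsSchwartz ψ)
    (hv : ∀ i, IsSchwartz (v i)) (x : Pt) :
    pd 2 (pd 2 (pd 2 (fun y => ∑ i, v i y * pd i ψ y))) x
        - ∑ i, v i x * pd i (pd 2 (pd 2 (pd 2 ψ))) x =
      ∑ i, (pd 2 (pd 2 (pd 2 (v i))) x * pd i ψ x + 3 * (pd 2 (pd 2 (v i)) x * pd 2 (pd i ψ) x)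
        + 3 * (pd 2 (v i) x * pd 2 (pd 2 (pd i ψ)) x)) := by
  have h (i : Fin 3) : IsSchwartz fun y => v i y * pd i ψ y := (hv i).mul (hψ.pd i)
  rw [pd_sum fun i => (h i).differentiable, pd_sum fun i => ((h i).pd 2).differentiable,
    pd_sum fun i => (((h i).pd 2).pd 2).differentiable, ← Finset.sum_sub_distrib]
  refine Finset.sum_congr rfl fun i _ => ?_
  rw [pd_pd_pd_mul (hv i) (hψ.pd i), ((hψ.pd 2).pd 2).pd_comm i 2, (hψ.pd 2).pd_comm i 2,
    hψ.pd_comm i 2]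
  ring

theorem gradHSq_nonneg (k : ℕ) (f : Pt → ℝ) : 0 ≤ gradHSq k f :=
  Finset.sum_nonneg fun _ _ => hSq_nonneg _ _

theorem gradVecHSq_nonneg (k : ℕ) (v : Fin 3 → Pt → ℝ) : 0 ≤ gradVecHSq k v :=
  Finset.sum_nonneg fun _ _ => gradHSq_nonneg _ _

theorem hSq_pd_le_gradHSq (k : ℕ) (f : Pt → ℝ) (i : Fin 3) : hSq k (pd i f) ≤ gradHSq k f :=
  Finset.single_le_sum (f := fun i => hSq k (pd i f)) (fun _ _ => hSq_nonneg _ _)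
    (Finset.mem_univ i)

/-- The commutator estimate at a fixed time. -/
theorem l2Sq_commutator_le {ψ : Pt → ℝ} {v : Fin 3 → Pt → ℝ} (hψ : IsSchwartz ψ)
    (hv : ∀ i, IsSchwartz (v i)) :
    l2Sq (fun x => pd 2 (pd 2 (pd 2 (fun y => ∑ i, v i y * pd i ψ y))) x
        - ∑ i, v i x * pd i (pd 2 (pd 2 (pd 2 ψ))) x) ≤
      396396 * (gradVecHSq 2 v * gradHSq 2 ψ) := by
  simp only [commutator_eq_sum hψ hv]
  set c : Fin 3 → Pt → ℝ := fun i x =>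
    pd 2 (pd 2 (pd 2 (v i))) x * pd i ψ x + 3 * (pd 2 (pd 2 (v i)) x * pd 2 (pd i ψ) x)
      + 3 * (pd 2 (v i) x * pd 2 (pd 2 (pd i ψ)) x) with hc
  have hcs (i : Fin 3) : IsSchwartz (c i) := by
    have h0 := hv i
    have hg := hψ.pd i
    have ha := (((h0.pd 2).pd 2).pd 2).mul hg
    have hb := ((h0.pd 2).pd 2).mul (hg.pd 2)
    have hd := (h0.pd 2).mul ((hg.pd 2).pd 2)
    convert (ha.add ((hb.add hb).add hb)).add ((hd.add hd).add hd) using 1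
    funext x
    simp only [hc]
    ring
  have hci (i : Fin 3) : ∫ x, c i x ^ 2 ≤ 132132 * (gradHSq 2 (v i) * gradHSq 2 ψ) := by
    refine (integral_sq_commutator_le (hv i) (hψ.pd i) 2).trans ?_
    gcongr
    · exact hSq_nonneg _ _
    · exact gradHSq_nonneg _ _
    · exact hSq_pd_le_gradHSq _ _ _
    · exact hSq_pd_le_gradHSq _ _ _
  calc l2Sq (fun x => ∑ i, c i x) ≤ ∫ x, 3 * ∑ i, c i x ^ 2 := by
        refine integral_mono_of_nonneg (ae_of_all _ fun x => sq_nonneg _)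
          ((integrable_finsetSum _ fun i _ => (hcs i).integrable_sq).const_mul 3)
          (ae_of_all _ fun x => ?_)
        simpa using sq_sum_le_card_mul_sum_sq (s := Finset.univ) (f := fun i => c i x)
    _ = 3 * ∑ i, ∫ x, c i x ^ 2 := by
        rw [integral_const_mul, integral_finsetSum _ fun i _ => (hcs i).integrable_sq]
    _ ≤ 3 * ∑ i, 132132 * (gradHSq 2 (v i) * gradHSq 2 ψ) :=
        mul_le_mul_of_nonneg_left (Finset.sum_le_sum fun i _ => hci i) (by norm_num)
    _ = 396396 * (gradVecHSq 2 v * gradHSq 2 ψ) := by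
        rw [← Finset.mul_sum, ← Finset.sum_mul, gradVecHSq]
        ring

/-- The commutator estimate:
`‖∂₃³(v·∇ψ) − v·∇∂₃³ψ‖_{L²_T(L²)} ≤ C ‖∇v‖_{L²_T(H²)} ‖∇ψ‖_{L^∞_T(H²)}`. -/
theorem stmt_18 :
    ∃ C : ℝ, 0 < C ∧ ∀ T : ℝ, 0 < T → ∀ (ψ : ℝ → Pt → ℝ) (v : Fin 3 → ℝ → Pt → ℝ),
      SmoothOn2 (Icc 0 T) ψ → (∀ j, SmoothOn2 (Icc 0 T) (v j)) →
      (∀ t ∈ Icc (0:ℝ) T, IsSchwartz (ψ t) ∧ ∀ j, IsSchwartz (v j t)) →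
      BddAbove ((fun t => Real.sqrt (gradHSq 2 (ψ t))) '' Icc 0 T) →
      IntervalIntegrable (fun t => gradVecHSq 2 fun j => v j t) volume 0 T →
      l2T T (fun t => Real.sqrt (l2Sq (fun x =>
          pd 2 (pd 2 (pd 2 (fun y => ∑ i, v i t y * pd i (ψ t) y))) x
            - ∑ i, v i t x * pd i (pd 2 (pd 2 (pd 2 (ψ t)))) x))) ≤
        C * (l2T T fun t => Real.sqrt (gradVecHSq 2 fun j => v j t))
          * (supT T fun t => Real.sqrt (gradHSq 2 (ψ t))) := by
  refine ⟨√396396, by positivity, fun T hT ψ v _ _ hS hbdd hint => ?_⟩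
  set S := supT T fun t => Real.sqrt (gradHSq 2 (ψ t))
  have hS0 : 0 ≤ S := Real.sSup_nonneg (by rintro _ ⟨t, -, rfl⟩; exact Real.sqrt_nonneg _)
  have hle (t : ℝ) (ht : t ∈ Icc 0 T) : gradHSq 2 (ψ t) ≤ S ^ 2 :=
    (Real.sqrt_le_left hS0).1 (le_csSup hbdd (mem_image_of_mem _ ht))
  have hl2 (f : Pt → ℝ) : 0 ≤ l2Sq f := integral_nonneg fun x => sq_nonneg _
  unfold l2T
  simp only [Real.sq_sqrt (hl2 _), Real.sq_sqrt (gradVecHSq_nonneg 2 _)]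
  rw [← Real.sqrt_mul (by norm_num), ← Real.sqrt_sq hS0, ← Real.sqrt_mul' _ (sq_nonneg S)]
  refine Real.sqrt_le_sqrt ?_
  rw [← intervalIntegral.integral_const_mul, ← intervalIntegral.integral_mul_const,
    intervalIntegral.integral_of_le hT.le, intervalIntegral.integral_of_le hT.le]
  refine integral_mono_of_nonneg (ae_of_all _ fun t => hl2 _)
    ((hint.const_mul 396396).mul_const (S ^ 2)).1 ?_
  filter_upwards [ae_restrict_mem measurableSet_Ioc] with t ht
  have ht' := Ioc_subset_Icc_self ht
  refine (l2Sq_commutator_le (hS t ht').1 (hS t ht').2).trans ?_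
  rw [mul_assoc]
  gcongr
  · exact gradVecHSq_nonneg _ _
  · exact hle t ht'

end
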